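/- Fix r ≥ 1 and n ≥ r. There exists a constant C_r > 0 depending only on r such that for every ε > 0, all real numbers a_0,…,a_{r−1} and all nonnegative reals s_0,…,s_{r−1}, the metric entropy of C_r({a_i},{s_i}) satisfies log N(ε, C_r({a_i},{s_i})) ≤ C_r ( √n · Σ_{j=1}^r n^{j−1} s_{j−1} / ε )^{1/r}. -/

import Mathlib

open MeasureTheory ProbabilityTheory
open scoped BigOperators

noncomputable section

/-- Zero-padding of a finite vector to a sequence on `ℕ`. -/
def pad {n : ℕ} (θ : Fin n → ℝ) : ℕ → ℝ := fun t => if h : t < n then θ ⟨t, h⟩ else 0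

/-- First-order forward difference of a sequence. -/
def dseq (f : ℕ → ℝ) : ℕ → ℝ := fun t => f (t + 1) - f t

/-- `DD r θ t` is the `t`-th entry (0-indexed) of the `r`-th order difference `D^{(r)} θ`
of the vector `θ ∈ ℝ^n`; only the entries `t < n - r` are meaningful. -/
def DD (r : ℕ) {n : ℕ} (θ : Fin n → ℝ) : ℕ → ℝ := dseq^[r] (pad θ)

/-- The ℓ¹ norm `‖D^{(r)} θ‖₁`. -/
def Dl1 (r : ℕ) {n : ℕ} (θ : Fin n → ℝ) : ℝ := ∑ t ∈ Finset.range (n - r), |DD r θ t|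

/-- The number of nonzero entries `‖D^{(r)} θ‖₀`. -/
def Dl0 (r : ℕ) {n : ℕ} (θ : Fin n → ℝ) : ℕ :=
  ((Finset.range (n - r)).filter fun t => DD r θ t ≠ 0).card

/-- Squared Euclidean norm. -/
def sqnorm {n : ℕ} (x : Fin n → ℝ) : ℝ := ∑ i, x i ^ 2

/-- Euclidean norm. -/
def eunorm {n : ℕ} (x : Fin n → ℝ) : ℝ := Real.sqrt (sqnorm x)

/-- `V^{(r)}(θ) = n^{r-1} ‖D^{(r)} θ‖₁`. -/
def Vr (r : ℕ) {n : ℕ} (θ : Fin n → ℝ) : ℝ := (n : ℝ) ^ ((r : ℤ) - 1) * Dl1 r θ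

/-- The constraint set `K^{(r)}(V) = {θ : ‖D^{(r)} θ‖₁ ≤ V n^{1-r}}`. -/
def Kset (r n : ℕ) (V : ℝ) : Set (Fin n → ℝ) := {θ | Dl1 r θ ≤ V * (n : ℝ) ^ (1 - (r : ℤ))}

/-- `est` is a least-squares projection onto the set `K`. -/
def IsProjOn {n : ℕ} (est : (Fin n → ℝ) → Fin n → ℝ) (K : Set (Fin n → ℝ)) : Prop :=
  ∀ y, est y ∈ K ∧ ∀ θ ∈ K, sqnorm (y - est y) ≤ sqnorm (y - θ)

/-- `est` is the penalized trend filtering estimator of order `r` with noise level `σ`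
and tuning parameter `lam`: it minimizes `½‖y - θ‖² + σ n^{r-1} lam ‖D^{(r)} θ‖₁`. -/
def IsPenEst (r : ℕ) {n : ℕ} (σ lam : ℝ) (est : (Fin n → ℝ) → Fin n → ℝ) : Prop :=
  ∀ y θ, 1 / 2 * sqnorm (y - est y) + σ * (n : ℝ) ^ ((r : ℤ) - 1) * lam * Dl1 r (est y) ≤
    1 / 2 * sqnorm (y - θ) + σ * (n : ℝ) ^ ((r : ℤ) - 1) * lam * Dl1 r θ

/-- The Gaussian measure `N_n(0, σ² I_n)` on `ℝ^n`. -/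
def gaussVec (n : ℕ) (σ : ℝ) : Measure (Fin n → ℝ) :=
  Measure.pi fun _ => gaussianReal 0 (σ ^ 2).toNNReal

/-- The risk `R(θ̂, θ*) = (1/n) E ‖θ̂(θ* + ξ) - θ*‖²` for `ξ ∼ N_n(0, σ² I_n)`. -/
def risk {n : ℕ} (σ : ℝ) (est : (Fin n → ℝ) → Fin n → ℝ) (θs : Fin n → ℝ) : ℝ :=
  1 / (n : ℝ) * ∫ ξ, sqnorm (est (θs + ξ) - θs) ∂gaussVec n σ

/-- `j` (with signs `sg`) enumerates, in increasing order and paper (1-indexed) convention,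
exactly the `r`-th order knots of `θ ∈ ℝ^n`; an index `2 ≤ m ≤ n - r + 1` is a knot when
`(D^{(r-1)}θ)_{m-1} ≠ (D^{(r-1)}θ)_m` (1-indexed entries), and its sign is `+1` when
`(D^{(r-1)}θ)_{m-1} < (D^{(r-1)}θ)_m` and `-1` otherwise. -/
def IsKnotSeq (r n : ℕ) (θ : Fin n → ℝ) (k : ℕ) (j : Fin k → ℕ) (sg : Fin k → ℝ) : Prop :=
  StrictMono j ∧ (∀ i, 2 ≤ j i ∧ j i ≤ n - r + 1) ∧
    (∀ m : ℕ, 2 ≤ m → m ≤ n - r + 1 →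
      (DD (r - 1) θ (m - 2) ≠ DD (r - 1) θ (m - 1) ↔ ∃ i, j i = m)) ∧
    ∀ i, sg i = if DD (r - 1) θ (j i - 2) < DD (r - 1) θ (j i - 1) then 1 else -1

/-- Extended knot sequence: `jext 0 = j_0 = 1`, `jext i = j_i` for `1 ≤ i ≤ k`, and
`jext (k+1) = j_{k+1} = n - r + 2`. -/
def jext (n r k : ℕ) (j : Fin k → ℕ) : ℕ → ℕ := fun i =>
  if i = 0 then 1 else if h : i - 1 < k then j ⟨i - 1, h⟩ else n - r + 2

/-- Extended sign sequence: `sgext i = 𝔯_i` for `1 ≤ i ≤ k` and `0` otherwise. -/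
def sgext (k : ℕ) (sg : Fin k → ℝ) : ℕ → ℝ := fun i =>
  if h : 0 < i ∧ i - 1 < k then sg ⟨i - 1, h.2⟩ else 0

/-- The lengths `n_0 = j_1 + r - 2`, `n_i = j_{i+1} - j_i` (`1 ≤ i ≤ k-1`),
`n_k = n - r + 2 - j_k`. -/
def nlen (n r k : ℕ) (j : Fin k → ℕ) : ℕ → ℕ := fun i =>
  if i = 0 then jext n r k j 1 + r - 2 else jext n r k j (i + 1) - jext n r k j i

/-- `n_{i*} = min(n_i, n/(k+1))`. -/
def nstar (n r k : ℕ) (j : Fin k → ℕ) (i : ℕ) : ℝ :=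
  min (nlen n r k j i : ℝ) ((n : ℝ) / ((k : ℝ) + 1))

/-- `δ_r(θ)²` defined from the knot data of `θ`. -/
def deltaSq (n r k : ℕ) (j : Fin k → ℕ) (sg : Fin k → ℝ) : ℝ :=
  nstar n r k j 0 ^ (1 - 2 * (r : ℤ)) + nstar n r k j k ^ (1 - 2 * (r : ℤ)) +
    ∑ i ∈ Finset.Ico 1 k,
      if sgext k sg i ≠ sgext k sg (i + 1) then nstar n r k j i ^ (1 - 2 * (r : ℤ)) else 0

/-- `Δ_r(θ)` defined from the knot data of `θ`. -/
def DeltaR (n r k : ℕ) (j : Fin k → ℕ) (sg : Fin k → ℝ) : ℝ :=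
  ((k : ℝ) + 1) / (n : ℝ) * Real.log (Real.exp 1 * (n : ℝ) / ((k : ℝ) + 1)) +
    deltaSq n r k j sg / (n : ℝ) * ((n : ℝ) / ((k : ℝ) + 1)) ^ (2 * (r : ℤ) - 1) *
      Real.log (Real.exp 1 * (n : ℝ) / ((k : ℝ) + 1)) +
    (Real.sqrt (deltaSq n r k j sg) / Real.sqrt (n : ℝ)) ^ ((1 : ℝ) / (r : ℝ))

/-- The minimum length condition with constant `c`: `n_i ≥ c n/(k+1)` for every `0 ≤ i ≤ k`
with `𝔯_i ≠ 𝔯_{i+1}` (where `𝔯_0 = 𝔯_{k+1} = 0`). -/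
def MinLen (n r k : ℕ) (j : Fin k → ℕ) (sg : Fin k → ℝ) (c : ℝ) : Prop :=
  ∀ i ≤ k, sgext k sg i ≠ sgext k sg (i + 1) →
    c * (n : ℝ) / ((k : ℝ) + 1) ≤ (nlen n r k j i : ℝ)

/-- The subdifferential of `g` at `θ`. -/
def subdiff {n : ℕ} (g : (Fin n → ℝ) → ℝ) (θ : Fin n → ℝ) : Set (Fin n → ℝ) :=
  {v | ∀ y, g θ + ∑ i, v i * (y i - θ i) ≤ g y}

/-- `v` is the minimum-norm element of `S`. -/
def IsMinNormIn {n : ℕ} (v : Fin n → ℝ) (S : Set (Fin n → ℝ)) : Prop :=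
  v ∈ S ∧ ∀ w ∈ S, eunorm v ≤ eunorm w

/-- `c • S`. -/
def scaleSet {n : ℕ} (c : ℝ) (S : Set (Fin n → ℝ)) : Set (Fin n → ℝ) := (c • ·) '' S

/-- The cone generated by `S`: `⋃_{c ≥ 0} c • S`. -/
def coneOf {n : ℕ} (S : Set (Fin n → ℝ)) : Set (Fin n → ℝ) := ⋃ c ∈ Set.Ici (0 : ℝ), scaleSet c S

/-- Euclidean distance from a point to a set. -/
def distSet {n : ℕ} (z : Fin n → ℝ) (S : Set (Fin n → ℝ)) : ℝ :=
  sInf ((fun v => eunorm (z - v)) '' S)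

/-- Gaussian mean squared distance `D(S) = E dist²(Z, S)`, `Z ∼ N_n(0, I_n)`. -/
def gaussMSD {n : ℕ} (S : Set (Fin n → ℝ)) : ℝ := ∫ z, distSet z S ^ 2 ∂gaussVec n 1

/-- `lam z` is, for each `z`, the minimizer over `λ ≥ 0` of `dist(z, λ S)`. -/
def IsLamFun {n : ℕ} (S : Set (Fin n → ℝ)) (lam : (Fin n → ℝ) → ℝ) : Prop :=
  ∀ z, 0 ≤ lam z ∧ ∀ μ : ℝ, 0 ≤ μ → distSet z (scaleSet (lam z) S) ≤ distSet z (scaleSet μ S)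

/-- Euclidean covering number of `K` at scale `ε`. -/
def covN {n : ℕ} (ε : ℝ) (K : Set (Fin n → ℝ)) : ℕ :=
  sInf {m : ℕ | ∃ a : Fin m → Fin n → ℝ, ∀ x ∈ K, ∃ i, eunorm (x - a i) ≤ ε}

/-- `K` `t`-shatters the (finite) index set `A`. -/
def fatShatters {n : ℕ} (K : Set (Fin n → ℝ)) (t : ℝ) (A : Finset (Fin n)) : Prop :=
  ∃ h : Fin n → ℝ, ∀ S : Finset (Fin n), S ⊆ A →
    ∃ θ ∈ K, (∀ i ∈ S, θ i ≤ h i) ∧ ∀ i ∈ A, i ∉ S → h i + t ≤ θ i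

/-- The fat shattering dimension `v(K, t)`. -/
def fatDim {n : ℕ} (K : Set (Fin n → ℝ)) (t : ℝ) : ℕ :=
  sSup {m : ℕ | ∃ A : Finset (Fin n), A.card = m ∧ fatShatters K t A}

/-- The tangent cone of `K` at `θ`. -/
def tanCone {n : ℕ} (K : Set (Fin n → ℝ)) (θ : Fin n → ℝ) : Set (Fin n → ℝ) :=
  closure {w | ∃ t : ℝ, 0 ≤ t ∧ ∃ η ∈ K, w = t • (η - θ)}

/-- `V_{a,b}(f) = Σ_{m=a+1}^{b} |f_m - f_{m-1}|` for the (paper 1-indexed) sequence whose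
`m`-th entry is `f (m-1)`. -/
def Vab (f : ℕ → ℝ) (a b : ℕ) : ℝ := ∑ t ∈ Finset.Ico (a - 1) (b - 1), |f (t + 1) - f t|

/-- `Acoef r n v j = Σ_{i=j}^n C(r+i-j-1, r-1) v_i` (paper 1-indexed). -/
def Acoef (r n : ℕ) (v : Fin n → ℝ) (jj : ℕ) : ℝ :=
  ∑ i : Fin n, (if jj ≤ i.1 + 1 then ((r + (i.1 + 1) - jj - 1).choose (r - 1) : ℝ) else 0) * v i

/-- The class `C_r({a_i}, {s_i})`. -/
def Cras (r n : ℕ) (a s : ℕ → ℝ) : Set (Fin n → ℝ) :=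
  {θ | (∀ i < r - 1, a i ≤ DD i θ 0 ∧ DD i θ 0 ≤ a i + s i) ∧
    a (r - 1) ≤ DD (r - 1) θ 0 ∧
    (∀ t : ℕ, t + 1 ≤ n - r → DD (r - 1) θ t ≤ DD (r - 1) θ (t + 1)) ∧
    DD (r - 1) θ (n - r) ≤ a (r - 1) + s (r - 1)}

/-- The class `C_r(a, V) = {θ : a ≤ (D^{(r-1)}θ)_1 ≤ ⋯ ≤ (D^{(r-1)}θ)_{n-r+1} ≤ a + V}`. -/
def CrMono (r n : ℕ) (a V : ℝ) : Set (Fin n → ℝ) :=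
  {θ | a ≤ DD (r - 1) θ 0 ∧
    (∀ t : ℕ, t + 1 ≤ n - r → DD (r - 1) θ t ≤ DD (r - 1) θ (t + 1)) ∧
    DD (r - 1) θ (n - r) ≤ a + V}


/-- Taylor remainder. -/
def tRem (k : ℕ) (g : ℕ → ℝ) (b h : ℕ) : ℝ :=
  g (b + h) - ∑ j ∈ Finset.range (k + 1), (h.choose j : ℝ) * dseq^[j] g b

def tTay (k : ℕ) (g : ℕ → ℝ) (b h : ℕ) : ℝ :=
  ∑ j ∈ Finset.range (k + 1), (h.choose j : ℝ) * dseq^[j] g b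

lemma tTay_zero (k : ℕ) (g : ℕ → ℝ) (b : ℕ) : tTay k g b 0 = g b := by
  unfold tTay
  rw [Finset.sum_range_succ']
  simp

lemma tRem_step (k : ℕ) (g : ℕ → ℝ) (b h : ℕ) :
    tRem (k + 1) g b (h + 1) = tRem (k + 1) g b h + tRem k (dseq g) b h := by
  unfold tRem
  rw [Finset.sum_range_succ' _ (k + 1), Finset.sum_range_succ' _ (k + 1)]
  have : ∑ j ∈ Finset.range (k + 1), (((h + 1).choose (j + 1) : ℕ) : ℝ) * dseq^[j + 1] g b =
      ∑ j ∈ Finset.range (k + 1), ((h.choose j : ℕ) : ℝ) * dseq^[j] (dseq g) b +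
      ∑ j ∈ Finset.range (k + 1), ((h.choose (j + 1) : ℕ) : ℝ) * dseq^[j + 1] g b := by
    rw [← Finset.sum_add_distrib]
    refine Finset.sum_congr rfl fun j _ => ?_
    rw [Nat.choose_succ_succ, ← Function.iterate_succ_apply]
    push_cast
    ring
  rw [this]
  have h2 : dseq g (b + h) = g (b + (h + 1)) - g (b + h) := rfl
  rw [h2]
  simp
  ring

lemma tRem_zero (k : ℕ) (g : ℕ → ℝ) (b : ℕ) : tRem k g b 0 = 0 := by
  have := tTay_zero k g b
  unfold tTay at this
  unfold tRem
  rw [this]; simp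

lemma tRem_bounds (k : ℕ) : ∀ (g : ℕ → ℝ) (_ : Monotone (dseq^[k] g)) (b h : ℕ),
    0 ≤ tRem k g b h ∧ tRem k g b h ≤ (h : ℝ) ^ k * (dseq^[k] g (b + h) - dseq^[k] g b) := by
  induction k with
  | zero =>
    intro g hg b h
    have : g b ≤ g (b + h) := hg (by omega)
    simp [tRem]
    exact this
  | succ k ih =>
    intro g hg b h
    rw [Function.iterate_succ_apply] at hg
    have key : ∀ s ≤ h, 0 ≤ tRem (k + 1) g b s ∧ tRem (k + 1) g b s ≤
        (s : ℝ) * ((h : ℝ) ^ k * (dseq^[k] (dseq g) (b + h) - dseq^[k] (dseq g) b)) := by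
      intro s
      induction s with
      | zero => intro _; simp [tRem_zero]
      | succ s ihs =>
        intro hs
        obtain ⟨h1, h2⟩ := ihs (by omega)
        obtain ⟨h3, h4⟩ := ih (dseq g) hg b s
        rw [tRem_step]
        refine ⟨by linarith, ?_⟩
        have h5 : (s : ℝ) ^ k * (dseq^[k] (dseq g) (b + s) - dseq^[k] (dseq g) b) ≤
            (h : ℝ) ^ k * (dseq^[k] (dseq g) (b + h) - dseq^[k] (dseq g) b) := by
          have e1 : dseq^[k] (dseq g) b ≤ dseq^[k] (dseq g) (b + s) := hg (by omega)
          have e2 : dseq^[k] (dseq g) (b + s) ≤ dseq^[k] (dseq g) (b + h) := hg (by omega)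
          have e3 : (s : ℝ) ≤ h := by exact_mod_cast (by omega : s ≤ h)
          gcongr
        push_cast
        linarith
    have := key h le_rfl
    rw [Function.iterate_succ_apply, pow_succ]
    refine ⟨this.1, this.2.trans (le_of_eq (by ring))⟩

lemma tTay_shift (k : ℕ) (f : ℕ → ℝ) (b h s : ℕ) :
    ∑ i ∈ Finset.range (k + 1), (s.choose i : ℝ) * tRem (k - i) (dseq^[i] f) b h =
      tTay k f (b + h) s - tTay k f b (h + s) := by
  unfold tTay tRem
  have h1 : ∀ j, ((h + s).choose j : ℝ) * dseq^[j] f b =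
      ∑ i ∈ Finset.range (j + 1), (fun i m => (s.choose i : ℝ) * (h.choose m : ℝ) * dseq^[m + i] f b) i (j - i) := by
    intro j
    rw [Nat.add_comm h s, Nat.add_choose_eq,
      Finset.Nat.sum_antidiagonal_eq_sum_range_succ (fun a b => s.choose a * h.choose b)]
    push_cast
    rw [Finset.sum_mul]
    refine Finset.sum_congr rfl fun i hi => ?_
    have := Finset.mem_range.1 hi
    rw [Nat.sub_add_cancel (by omega)]
  rw [Finset.sum_congr rfl fun j _ => h1 j, Finset.sum_range_diag_flip (k + 1)
    (fun i m => (s.choose i : ℝ) * (h.choose m : ℝ) * dseq^[m + i] f b), ← Finset.sum_sub_distrib]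
  refine Finset.sum_congr rfl fun i hi => ?_
  have := Finset.mem_range.1 hi
  rw [show k - i + 1 = k + 1 - i by omega, mul_sub, Finset.mul_sum]
  congr 1
  refine Finset.sum_congr rfl fun j _ => ?_
  rw [Function.iterate_add_apply]
  ring

lemma ext_exists (k : ℕ) : ∀ (g : ℕ → ℝ) (m : ℕ), 1 ≤ m → ∃ f : ℕ → ℝ,
    (∀ t < m + k, f t = g t) ∧ ∀ t, dseq^[k] f t = dseq^[k] g (min t (m - 1)) := by
  induction k with
  | zero =>
    intro g m hm
    refine ⟨fun t => g (min t (m - 1)), fun t ht => ?_, fun t => rfl⟩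
    simp only
    rw [min_eq_left (by omega)]
  | succ k ih =>
    intro g m hm
    obtain ⟨f', h1, h2⟩ := ih (dseq g) m hm
    have hd : dseq (fun t => g 0 + ∑ s ∈ Finset.range t, f' s) = f' := by
      funext t
      simp [dseq, Finset.sum_range_succ]
    refine ⟨fun t => g 0 + ∑ s ∈ Finset.range t, f' s, fun t ht => ?_, fun t => ?_⟩
    · induction t with
      | zero => simp
      | succ t iht =>
        have := iht (by omega)
        simp only at this ⊢
        rw [Finset.sum_range_succ, ← add_assoc, this, h1 t (by omega)]
        simp [dseq]
    · rw [Function.iterate_succ_apply, Function.iterate_succ_apply, hd, h2]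

lemma dseq_congr (i : ℕ) : ∀ (f g : ℕ → ℝ) (m : ℕ), (∀ t < m + i, f t = g t) →
    ∀ t < m, dseq^[i] f t = dseq^[i] g t := by
  induction i with
  | zero => intro f g m h t ht; exact h t ht
  | succ i ih =>
    intro f g m h t ht
    rw [Function.iterate_succ_apply, Function.iterate_succ_apply]
    refine ih _ _ m (fun t ht => ?_) t ht
    simp only [dseq]
    rw [h t (by omega), h (t + 1) (by omega)]

/-- coefficients -/
def cf (k L : ℕ) (f : ℕ → ℝ) (a : ℕ → ℝ) : ℕ → ℕ → ℕ → ℝ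
  | 0, _, i => dseq^[i] f 0 - a i
  | l + 1, q, i => tRem (k - i) (dseq^[i] f) (2 * 2 ^ (L - (l + 1)) * (q / 2))
      (2 ^ (L - (l + 1)) * (q % 2))

lemma cf_repr (k L : ℕ) (f : ℕ → ℝ) (a : ℕ → ℝ) (t : ℕ) (ht : t < 2 ^ L) (m : ℕ) (hm : m ≤ L) :
    tTay k f (2 ^ (L - m) * (t / 2 ^ (L - m))) (t % 2 ^ (L - m)) =
      ∑ i ∈ Finset.range (k + 1), (t.choose i : ℝ) * a i +
      ∑ l ∈ Finset.range (m + 1), ∑ i ∈ Finset.range (k + 1),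
        ((t % 2 ^ (L - l)).choose i : ℝ) * cf k L f a l (t / 2 ^ (L - l)) i := by
  induction m with
  | zero =>
    simp only [Nat.sub_zero, Nat.div_eq_of_lt ht, Nat.mod_eq_of_lt ht, zero_add,
      Finset.sum_range_one, cf, ← Finset.sum_add_distrib, tTay]
    refine Finset.sum_congr rfl fun i _ => ?_
    simp
    ring
  | succ m ih =>
    rw [Finset.sum_range_succ _ (m + 1), ← add_assoc, ← ih (by omega)]
    simp only [cf]
    rw [tTay_shift]
    have e : 2 ^ (L - m) = 2 * 2 ^ (L - (m + 1)) := by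
      rw [← pow_succ', show L - (m + 1) + 1 = L - m by omega]
    rw [e]
    generalize 2 ^ (L - (m + 1)) = h
    have e1 : t / (2 * h) = t / h / 2 := by rw [Nat.div_div_eq_div_mul, mul_comm]
    have e2 : t % (2 * h) = h * (t / h % 2) + t % h := by
      rw [mul_comm 2 h, Nat.mod_mul, add_comm]
    have e3 : 2 * h * (t / h / 2) + h * (t / h % 2) = h * (t / h) := by
      conv_rhs => rw [← Nat.div_add_mod (t / h) 2]
      ring
    rw [e1, e2, e3]
    ring

lemma cf_nonneg (k L : ℕ) (f a : ℕ → ℝ) (hf : Monotone (dseq^[k] f))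
    (ha : ∀ i < k + 1, a i ≤ dseq^[i] f 0) (l q i : ℕ) (hi : i < k + 1) :
    0 ≤ cf k L f a l q i := by
  cases l with
  | zero => simp only [cf]; linarith [ha i hi]
  | succ l =>
    simp only [cf]
    refine (tRem_bounds _ _ ?_ _ _).1
    rw [← Function.iterate_add_apply, Nat.sub_add_cancel (by omega)]
    exact hf

lemma tele (F : ℕ → ℝ) (V : ℝ) (hV : ∀ t, F t - F 0 ≤ V) (hV0 : 0 ≤ V) (h m : ℕ) :
    ∑ q ∈ Finset.range m, (F (h * q) - F (h * (q - 1))) ≤ V := by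
  cases m with
  | zero => simpa using hV0
  | succ m =>
    have : ∑ q ∈ Finset.range (m + 1), (F (h * q) - F (h * (q - 1))) = F (h * m) - F 0 := by
      induction m with
      | zero => simp
      | succ m ih => rw [Finset.sum_range_succ, ih]; simp
    rw [this]; exact hV _

lemma cf_sum (k L : ℕ) (f a s : ℕ → ℝ) (hf : Monotone (dseq^[k] f)) (hs : ∀ i < k + 1, 0 ≤ s i)
    (has : ∀ i < k + 1, dseq^[i] f 0 ≤ a i + s i)
    (hV : ∀ t, dseq^[k] f t - dseq^[k] f 0 ≤ s k)
    (l i : ℕ) (hl : l ≤ L) (hi : i < k + 1) :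
    ∑ q ∈ Finset.range (2 ^ l), ((2 : ℝ) ^ (L - l)) ^ i * cf k L f a l q i ≤
      (∑ j ∈ Finset.range (k + 1), ((2 : ℝ) ^ L) ^ j * s j) / 2 ^ (l * k) := by
  have hle : ∀ j < k + 1, ((2 : ℝ) ^ L) ^ j * s j ≤
      ∑ j ∈ Finset.range (k + 1), ((2 : ℝ) ^ L) ^ j * s j := by
    intro j hj
    refine Finset.single_le_sum (f := fun j => ((2 : ℝ) ^ L) ^ j * s j) (fun x hx => ?_)
      (Finset.mem_range.2 hj)
    have := hs x (Finset.mem_range.1 hx)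
    positivity
  cases l with
  | zero =>
    simp only [pow_zero, Finset.sum_range_one, cf, Nat.sub_zero, zero_mul, div_one]
    refine le_trans ?_ (hle i hi)
    have := has i hi
    gcongr
    linarith
  | succ l =>
    have hsk := hs k (by omega)
    rw [le_div_iff₀ (by positivity)]
    refine le_trans ?_ (hle k (by omega))
    have e : ((2 : ℝ) ^ L) ^ k = ((2 : ℝ) ^ (L - (l + 1))) ^ k * 2 ^ ((l + 1) * k) := by
      rw [pow_mul, ← mul_pow, ← pow_add, Nat.sub_add_cancel hl]
    rw [e]
    have : ∑ q ∈ Finset.range (2 ^ (l + 1)), ((2 : ℝ) ^ (L - (l + 1))) ^ i * cf k L f a (l + 1) q i ≤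
        ((2 : ℝ) ^ (L - (l + 1))) ^ k * s k := by
      refine le_trans ?_ (mul_le_mul_of_nonneg_left
        (tele (dseq^[k] f) (s k) hV hsk (2 ^ (L - (l + 1))) (2 ^ (l + 1))) (by positivity))
      rw [Finset.mul_sum]
      refine Finset.sum_le_sum fun q _ => ?_
      simp only [cf]
      have hcast : (2 : ℝ) ^ (L - (l + 1)) = ((2 ^ (L - (l + 1)) : ℕ) : ℝ) := by push_cast; rfl
      rw [hcast]
      generalize 2 ^ (L - (l + 1)) = h
      have hit : dseq^[k - i] (dseq^[i] f) = dseq^[k] f := by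
        rw [← Function.iterate_add_apply, Nat.sub_add_cancel (by omega)]
      have hb := (tRem_bounds (k - i) (dseq^[i] f) (by rw [hit]; exact hf)
        (2 * h * (q / 2)) (h * (q % 2))).2
      rw [hit] at hb
      have e3 : 2 * h * (q / 2) + h * (q % 2) = h * q := by
        conv_rhs => rw [← Nat.div_add_mod q 2]
        ring
      rw [e3] at hb
      have e4 : h * (q - 1) ≤ 2 * h * (q / 2) := by
        rw [mul_comm 2 h, mul_assoc]
        exact Nat.mul_le_mul_left _ (by omega)
      have m1 : dseq^[k] f (h * (q - 1)) ≤ dseq^[k] f (2 * h * (q / 2)) := hf e4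
      have m2 : dseq^[k] f (2 * h * (q / 2)) ≤ dseq^[k] f (h * q) := hf (by omega)
      have e5 : ((h * (q % 2) : ℕ) : ℝ) ≤ h := by
        have : h * (q % 2) ≤ h * 1 := Nat.mul_le_mul_left _ (by omega)
        rw [mul_one] at this
        exact_mod_cast this
      calc (h : ℝ) ^ i * tRem (k - i) (dseq^[i] f) (2 * h * (q / 2)) (h * (q % 2))
          ≤ (h : ℝ) ^ i * (((h * (q % 2) : ℕ) : ℝ) ^ (k - i) *
            (dseq^[k] f (h * q) - dseq^[k] f (2 * h * (q / 2)))) := by gcongr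
        _ ≤ (h : ℝ) ^ i * ((h : ℝ) ^ (k - i) *
            (dseq^[k] f (h * q) - dseq^[k] f (h * (q - 1)))) := by
            gcongr
        _ = _ := by
            rw [← mul_assoc, ← pow_add, show i + (k - i) = k by omega]
    calc _ ≤ ((2 : ℝ) ^ (L - (l + 1))) ^ k * s k * 2 ^ ((l + 1) * k) := by gcongr
      _ = _ := by ring

lemma gf_count {ι : Type} [Fintype ι] [DecidableEq ι] (w : ι → ℝ) (hw : ∀ i, 0 < w i) (B : ℝ) (hB : 0 ≤ B) :
    ∃ Q : Finset (ι → ℕ), (∀ q : ι → ℕ, ∑ i, w i * (q i : ℝ) ≤ B → q ∈ Q) ∧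
      (Q.card : ℝ) ≤ Real.exp (B + ∑ i, -Real.log (1 - Real.exp (-w i))) := by
  classical
  obtain ⟨K, hK⟩ := exists_nat_gt (∑ i, B / w i)
  refine ⟨(Fintype.piFinset fun _ : ι => Finset.range K).filter fun q => ∑ i, w i * (q i : ℝ) ≤ B,
    fun q hq => ?_, ?_⟩
  · rw [Finset.mem_filter]
    refine ⟨Fintype.mem_piFinset.2 fun i => Finset.mem_range.2 ?_, hq⟩
    have h1 : w i * (q i : ℝ) ≤ B := le_trans (Finset.single_le_sum (f := fun i => w i * (q i : ℝ))
      (fun j _ => by have := hw j; positivity) (Finset.mem_univ i)) hq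
    have h2 : (q i : ℝ) ≤ B / w i := by rw [le_div_iff₀ (hw i)]; linarith
    have h3 : B / w i ≤ ∑ i, B / w i := Finset.single_le_sum (f := fun i => B / w i)
      (fun j _ => div_nonneg hB (hw j).le) (Finset.mem_univ i)
    exact_mod_cast lt_of_le_of_lt (h2.trans h3) hK
  · have hx : ∀ i, 0 < 1 - Real.exp (-w i) := fun i => by
      have : Real.exp (-w i) < 1 := by rw [Real.exp_lt_one_iff]; linarith [hw i]
      linarith
    calc ((((Fintype.piFinset fun _ : ι => Finset.range K).filter
            fun q => ∑ i, w i * (q i : ℝ) ≤ B).card : ℕ) : ℝ)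
        = ∑ q ∈ (Fintype.piFinset fun _ : ι => Finset.range K).filter
            (fun q => ∑ i, w i * (q i : ℝ) ≤ B), (1 : ℝ) := by simp
      _ ≤ ∑ q ∈ (Fintype.piFinset fun _ : ι => Finset.range K).filter
            (fun q => ∑ i, w i * (q i : ℝ) ≤ B), Real.exp B * ∏ i, Real.exp (-w i) ^ (q i) := by
          refine Finset.sum_le_sum fun q hq => ?_
          have := (Finset.mem_filter.1 hq).2
          have e : ∏ i, Real.exp (-w i) ^ (q i) = Real.exp (-∑ i, w i * (q i : ℝ)) := by
            rw [← Finset.sum_neg_distrib, Real.exp_sum]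
            refine Finset.prod_congr rfl fun i _ => ?_
            rw [← Real.exp_nat_mul]
            congr 1
            ring
          rw [e, ← Real.exp_add]
          exact Real.one_le_exp (by linarith)
      _ ≤ ∑ q ∈ (Fintype.piFinset fun _ : ι => Finset.range K),
            Real.exp B * ∏ i, Real.exp (-w i) ^ (q i) := by
          refine Finset.sum_le_sum_of_subset_of_nonneg (Finset.filter_subset _ _) fun q _ _ => ?_
          positivity
      _ = Real.exp B * ∏ i, ∑ j ∈ Finset.range K, Real.exp (-w i) ^ j := by
          rw [← Finset.mul_sum, Finset.prod_univ_sum]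
      _ ≤ Real.exp B * ∏ i, (1 - Real.exp (-w i))⁻¹ := by
          gcongr with i _
          rw [← tsum_geometric_of_lt_one (Real.exp_pos _).le (by linarith [hx i])]
          exact Summable.sum_le_tsum _ (fun j _ => by positivity)
            (summable_geometric_of_lt_one (Real.exp_pos _).le (by linarith [hx i]))
      _ = _ := by
          rw [Real.exp_add, Real.exp_sum]
          congr 1
          refine Finset.prod_congr rfl fun i _ => ?_
          rw [Real.exp_neg (Real.log _), Real.exp_log (hx i)]

lemma neglog_bound (x : ℝ) (hx0 : 0 ≤ x) (hx : x ≤ 1 / 2) : -Real.log (1 - x) ≤ 2 * x := by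
  rw [← Real.log_inv]
  refine (Real.log_le_sub_one_of_pos (by rw [inv_pos]; linarith)).trans ?_
  rw [sub_le_iff_le_add, inv_le_iff_one_le_mul₀ (by linarith)]
  nlinarith

def rho (l m : ℕ) : ℝ := (7 / 8 : ℝ) ^ ((l - m) + (m - l))

lemma rho_pos (l m : ℕ) : 0 < rho l m := by unfold rho; positivity

lemma geo_bd (n : ℕ) : ∑ j ∈ Finset.range n, (7 / 8 : ℝ) ^ j ≤ 8 := by
  rw [geom_sum_eq (by norm_num)]
  have : 0 ≤ (7 / 8 : ℝ) ^ n := by positivity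
  rw [div_le_iff_of_neg (by norm_num)]
  linarith

lemma rho_sum (n m : ℕ) : ∑ l ∈ Finset.range n, rho l m ≤ 16 := by
  have h1 : ∀ n, n ≤ m + 1 → ∑ l ∈ Finset.range n, rho l m ≤ 8 * (7 / 8) ^ (m + 1 - n) := by
    intro n
    induction n with
    | zero => intro _; simp; positivity
    | succ n ih =>
      intro hn
      rw [Finset.sum_range_succ]
      have := ih (by omega)
      rw [show m + 1 - n = (m - n) + 1 by omega, pow_succ] at this
      rw [show m + 1 - (n + 1) = m - n by omega]
      unfold rho at *
      rw [show n - m + (m - n) = m - n by omega]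
      linarith
  have h2 : ∀ k, ∑ l ∈ Finset.range (m + 1 + k), rho l m ≤ 16 := by
    intro k
    rw [Finset.sum_range_add]
    have a1 := h1 (m + 1) le_rfl
    have a2 : ∑ x ∈ Finset.range k, rho (m + 1 + x) m ≤ ∑ x ∈ Finset.range k, (7 / 8 : ℝ) ^ x := by
      refine Finset.sum_le_sum fun x _ => ?_
      unfold rho
      exact pow_le_pow_of_le_one (by norm_num) (by norm_num) (by omega)
    have a3 := geo_bd k
    simp at a1
    linarith
  refine le_trans ?_ (h2 n)
  exact Finset.sum_le_sum_of_subset_of_nonneg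
    (Finset.range_mono (by omega)) fun l _ _ => (rho_pos l m).le

lemma half_pow_le (j : ℕ) : (1 / 2 : ℝ) ^ j ≤ (7 / 8) ^ j :=
  pow_le_pow_left₀ (by norm_num) (by norm_num) j

lemma params (k : ℕ) : ∃ K : ℝ, 0 < K ∧ ∀ l m : ℕ, ∃ d w : ℝ, 0 < d ∧ 0 < w ∧
    (256 * ((k : ℝ) + 1) ^ 2 * (d * d) ≤ rho l m ^ 2 ∨
      256 * ((k : ℝ) + 1) ^ 2 * (d * ((2 ^ m) ^ (k + 1) / 2 ^ (l * (k + 1)))) ≤ rho l m ^ 2) ∧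
    w * ((2 ^ m) ^ (k + 1) / 2 ^ (l * k) / d) + 2 ^ l * (-Real.log (1 - Real.exp (-w))) ≤
      K * 2 ^ m * rho l m := by
  obtain ⟨c, hc⟩ : ∃ c : ℝ, c = 1 / (256 * ((k : ℝ) + 1) ^ 2) := ⟨_, rfl⟩
  have hk0 : (0 : ℝ) ≤ k := by positivity
  have hc0 : 0 < c := by rw [hc]; positivity
  have hc1 : 256 * ((k : ℝ) + 1) ^ 2 * c = 1 := by rw [hc]; field_simp
  have hc2 : c ≤ 1 := by nlinarith
  refine ⟨7 / c + 2 * (k + 3) , by positivity, fun l m => ?_⟩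
  rcases le_total m l with h | h
  · obtain ⟨j, rfl⟩ := Nat.exists_eq_add_of_le h
    have hrho : rho (m + j) m = (7 / 8) ^ j := by
      unfold rho
      congr 1
      omega
    rw [hrho]
    refine ⟨c * (3 / 2) ^ j / 2 ^ (j * k), 2 * j + 1, by positivity, by positivity, Or.inr ?_, ?_⟩
    · have e : 256 * ((k : ℝ) + 1) ^ 2 * (c * (3 / 2) ^ j / 2 ^ (j * k) *
          ((2 ^ m) ^ (k + 1) / 2 ^ ((m + j) * (k + 1)))) =
          (256 * ((k : ℝ) + 1) ^ 2 * c) * ((3 / 4) ^ j / (2 ^ (j * k)) ^ 2) := by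
        rw [show (3 / 4 : ℝ) ^ j = (3 / 2) ^ j / 2 ^ j by rw [← div_pow]; norm_num]
        rw [← pow_mul, show (m + j) * (k + 1) = m * (k + 1) + (j * k + j) by ring]
        simp only [pow_add]
        field_simp
      rw [e, hc1, one_mul]
      calc (3 / 4 : ℝ) ^ j / (2 ^ (j * k)) ^ 2 ≤ (3 / 4 : ℝ) ^ j :=
            div_le_self (by positivity) (one_le_pow₀ (one_le_pow₀ (by norm_num)))
        _ ≤ _ := by
            rw [← pow_mul, mul_comm j 2, pow_mul]
            gcongr
            norm_num
    · have e : (2 * (j : ℝ) + 1) * ((2 ^ m) ^ (k + 1) / 2 ^ ((m + j) * k) /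
          (c * (3 / 2) ^ j / 2 ^ (j * k))) = (2 * j + 1) * (2 / 3) ^ j * 2 ^ m / c := by
        rw [show (2 / 3 : ℝ) ^ j = 1 / (3 / 2) ^ j by rw [← one_div_pow]; norm_num]
        rw [← pow_mul, show (m + j) * k = m * k + j * k by ring,
          show m * (k + 1) = m * k + m by ring]
        simp only [pow_add]
        field_simp
      rw [e]
      have b1 : (2 * (j : ℝ) + 1) * (2 / 3) ^ j ≤ 7 * (7 / 8) ^ j := by
        have := one_add_mul_le_pow (a := (5 / 16 : ℝ)) (by norm_num) j
        calc (2 * (j : ℝ) + 1) * (2 / 3) ^ j ≤ (7 * (1 + 5 / 16) ^ j) * (2 / 3) ^ j := by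
              gcongr
              have : (0 : ℝ) ≤ j := by positivity
              linarith
          _ = _ := by rw [mul_assoc, ← mul_pow]; norm_num
      have hx : Real.exp (-(2 * (j : ℝ) + 1)) ≤ 1 / 2 * (1 / 4) ^ j := by
        have e1 : Real.exp (-1) ≤ 1 / 2 := by
          rw [Real.exp_neg, inv_le_comm₀ (Real.exp_pos _) (by norm_num)]
          have := Real.add_one_le_exp 1
          linarith
        have e2 : Real.exp (-(2 * (j : ℝ) + 1)) = Real.exp (-1) * ((Real.exp (-1)) ^ 2) ^ j := by
          rw [← Real.exp_nat_mul, ← Real.exp_nat_mul, ← Real.exp_add]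
          congr 1
          push_cast
          ring
        rw [e2]
        have e3 : Real.exp (-1) ^ 2 ≤ 1 / 4 := by
          have := Real.exp_pos (-1)
          nlinarith
        gcongr
      have hx2 : (1 / 2 : ℝ) * (1 / 4) ^ j ≤ 1 / 2 := by
        have : (1 / 4 : ℝ) ^ j ≤ 1 := pow_le_one₀ (by norm_num) (by norm_num)
        linarith
      have b2 := neglog_bound _ (Real.exp_pos _).le (hx.trans hx2)
      have b3 : (2 : ℝ) ^ (m + j) * (-Real.log (1 - Real.exp (-(2 * (j : ℝ) + 1)))) ≤
          2 ^ m * (7 / 8) ^ j := by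
        calc _ ≤ (2 : ℝ) ^ (m + j) * ((1 / 4) ^ j) := by
              gcongr
              linarith
          _ = 2 ^ m * (1 / 2) ^ j := by
              rw [pow_add, mul_assoc, ← mul_pow]
              norm_num
          _ ≤ _ := mul_le_mul_of_nonneg_left (half_pow_le j) (by positivity)
      have b4 : (2 * (j : ℝ) + 1) * (2 / 3) ^ j * 2 ^ m / c ≤ 7 * (7 / 8) ^ j * 2 ^ m / c := by
        gcongr
      have b5 : (0 : ℝ) ≤ (2 * k + 5) * (2 ^ m * (7 / 8) ^ j) := by positivity
      calc _ ≤ 7 * (7 / 8) ^ j * 2 ^ m / c + 2 ^ m * (7 / 8) ^ j := add_le_add b4 b3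
        _ ≤ 7 * (7 / 8) ^ j * 2 ^ m / c + 2 ^ m * (7 / 8) ^ j +
            (2 * k + 5) * (2 ^ m * (7 / 8) ^ j) := by linarith
        _ = _ := by ring
  · obtain ⟨j, rfl⟩ := Nat.exists_eq_add_of_le h
    have hrho : rho l (l + j) = (7 / 8) ^ j := by
      unfold rho
      congr 1
      omega
    rw [hrho]
    refine ⟨c / 2 ^ j, 1 / 2 ^ (j * (k + 2)), by positivity, by positivity, Or.inl ?_, ?_⟩
    · have e : 256 * ((k : ℝ) + 1) ^ 2 * (c / 2 ^ j * (c / 2 ^ j)) =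
          (256 * ((k : ℝ) + 1) ^ 2 * c) * (c * ((1 / 2) ^ j) ^ 2) := by
        rw [one_div_pow]
        field_simp
      rw [e, hc1, one_mul]
      calc c * ((1 / 2 : ℝ) ^ j) ^ 2 ≤ 1 * ((7 / 8) ^ j) ^ 2 := by
            have := half_pow_le j
            gcongr
        _ = _ := one_mul _
    · have e : 1 / (2 : ℝ) ^ (j * (k + 2)) * ((2 ^ (l + j)) ^ (k + 1) / 2 ^ (l * k) / (c / 2 ^ j)) =
          2 ^ (l + j) * (1 / 2) ^ j / c := by
        rw [one_div_pow, ← pow_mul]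
        rw [show (l + j) * (k + 1) = l * k + j * k + l + j by ring,
          show j * (k + 2) = j * k + j + j by ring]
        simp only [pow_add]
        field_simp
      rw [e]
      set w : ℝ := 1 / 2 ^ (j * (k + 2)) with hw
      have hw0 : 0 < w := by positivity
      have hw1 : w ≤ 1 := by
        rw [hw, div_le_one (by positivity)]
        exact one_le_pow₀ (by norm_num)
      have hlow : w / 2 ≤ 1 - Real.exp (-w) := by
        have h1 := Real.add_one_le_exp w
        have h2 : Real.exp (-w) * Real.exp w = 1 := by rw [← Real.exp_add]; simp
        have h3 := Real.exp_pos (-w)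
        nlinarith
      have b2 : -Real.log (1 - Real.exp (-w)) ≤ (k + 2) * (j + 1) := by
        have h1 := Real.log_le_log (by positivity) hlow
        have h2 : Real.log (w / 2) = -((j * (k + 2) + 1 : ℕ) * Real.log 2) := by
          rw [hw, div_div, ← pow_succ, Real.log_div one_ne_zero (by positivity), Real.log_one,
            Real.log_pow]
          ring
        have h3 : Real.log 2 ≤ 1 := by
          have := Real.log_le_sub_one_of_pos (x := 2) (by norm_num)
          linarith
        have h4 : ((j * (k + 2) + 1 : ℕ) : ℝ) * Real.log 2 ≤ ((j * (k + 2) + 1 : ℕ) : ℝ) :=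
          mul_le_of_le_one_right (by positivity) h3
        push_cast at h2 h4
        have : (0 : ℝ) ≤ j := by positivity
        nlinarith
      have b1 : ((j : ℝ) + 1) * (1 / 2) ^ j ≤ 2 * (7 / 8) ^ j := by
        have := one_add_mul_le_pow (a := (3 / 4 : ℝ)) (by norm_num) j
        calc ((j : ℝ) + 1) * (1 / 2) ^ j ≤ (2 * (1 + 3 / 4) ^ j) * (1 / 2) ^ j := by
              gcongr
              have : (0 : ℝ) ≤ j := by positivity
              linarith
          _ = _ := by rw [mul_assoc, ← mul_pow]; norm_num
      have b3 : (2 : ℝ) ^ l * (-Real.log (1 - Real.exp (-w))) ≤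
          2 * (k + 2) * 2 ^ (l + j) * (7 / 8) ^ j := by
        calc _ ≤ (2 : ℝ) ^ l * ((k + 2) * (j + 1)) := by gcongr
          _ = (k + 2) * 2 ^ (l + j) * ((j + 1) * (1 / 2) ^ j) := by
              rw [pow_add, one_div_pow]; field_simp
          _ ≤ (k + 2) * 2 ^ (l + j) * (2 * (7 / 8) ^ j) := by gcongr
          _ = _ := by ring
      have b4 : (2 : ℝ) ^ (l + j) * (1 / 2) ^ j / c ≤ 7 * 2 ^ (l + j) * (7 / 8) ^ j / c := by
        have : (2 : ℝ) ^ (l + j) * (1 / 2) ^ j ≤ 2 ^ (l + j) * (7 / 8) ^ j := mul_le_mul_of_nonneg_left (half_pow_le j) (by positivity)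
        have h2 : (0 : ℝ) ≤ 2 ^ (l + j) * (7 / 8) ^ j := by positivity
        refine div_le_div_of_nonneg_right ?_ hc0.le
        linarith
      have b5 : (0 : ℝ) ≤ 2 * (2 ^ (l + j) * (7 / 8) ^ j) := by positivity
      calc _ ≤ 7 * 2 ^ (l + j) * (7 / 8) ^ j / c + 2 * (k + 2) * 2 ^ (l + j) * (7 / 8) ^ j :=
            add_le_add b4 b3
        _ ≤ 7 * 2 ^ (l + j) * (7 / 8) ^ j / c + 2 * (k + 2) * 2 ^ (l + j) * (7 / 8) ^ j +
            2 * (2 ^ (l + j) * (7 / 8) ^ j) := by linarith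
        _ = _ := by ring

lemma sum_blocks (g : ℕ → ℝ) (h : ℕ) (m : ℕ) :
    ∑ t ∈ Finset.range (m * h), g (t / h) = h * ∑ p ∈ Finset.range m, g p := by
  induction m with
  | zero => simp
  | succ m ih =>
    rw [add_mul, one_mul, Finset.sum_range_add, ih, Finset.sum_range_succ, mul_add]
    congr 1
    rw [Finset.sum_congr rfl (g := fun _ => g m)]
    · simp
    · intro x hx
      have hx := Finset.mem_range.1 hx
      rw [mul_comm, Nat.mul_add_div (by omega), Nat.div_eq_of_lt hx, add_zero]

lemma level_err (r h m : ℕ) (hh : 0 < h) (u y : ℕ → ℕ → ℝ) (δ S : ℝ) (hδ : 0 ≤ δ)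
    (hu0 : ∀ p, ∀ i < r, 0 ≤ u p i) (hu1 : ∀ p, ∀ i < r, u p i ≤ δ)
    (hu2 : ∀ p, ∀ i < r, u p i ≤ y p i)
    (hy : ∀ i < r, ∑ p ∈ Finset.range m, y p i ≤ S) :
    ∑ t ∈ Finset.range (m * h),
      (∑ i ∈ Finset.range r, ((t % h).choose i : ℝ) / (h : ℝ) ^ i * u (t / h) i) ^ 2 ≤
      h * r ^ 2 * δ * (m * δ) ∧
    ∑ t ∈ Finset.range (m * h),
      (∑ i ∈ Finset.range r, ((t % h).choose i : ℝ) / (h : ℝ) ^ i * u (t / h) i) ^ 2 ≤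
      h * r ^ 2 * δ * S := by
  have hh' : (0 : ℝ) < h := by exact_mod_cast hh
  have main : ∑ t ∈ Finset.range (m * h),
      (∑ i ∈ Finset.range r, ((t % h).choose i : ℝ) / (h : ℝ) ^ i * u (t / h) i) ^ 2 ≤
      h * r * δ * ∑ i ∈ Finset.range r, ∑ p ∈ Finset.range m, u p i := by
    calc _ ≤ ∑ t ∈ Finset.range (m * h), (fun p => r * (δ * ∑ i ∈ Finset.range r, u p i)) (t / h) := by
          refine Finset.sum_le_sum fun t _ => ?_
          simp only
          have h1 : (∑ i ∈ Finset.range r, ((t % h).choose i : ℝ) / (h : ℝ) ^ i * u (t / h) i) ^ 2 ≤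
              (∑ i ∈ Finset.range r, u (t / h) i) ^ 2 := by
            refine pow_le_pow_left₀ (Finset.sum_nonneg fun i hi => ?_)
              (Finset.sum_le_sum fun i hi => ?_) 2
            · have := hu0 (t / h) i (Finset.mem_range.1 hi)
              positivity
            · refine mul_le_of_le_one_left (hu0 _ _ (Finset.mem_range.1 hi)) ?_
              rw [div_le_one (by positivity)]
              have h2 : (t % h).choose i ≤ h ^ i :=
                (Nat.choose_le_pow _ _).trans (Nat.pow_le_pow_left (Nat.mod_lt _ hh).le _)
              exact_mod_cast h2
          refine h1.trans ?_
          have h2 := sq_sum_le_card_mul_sum_sq (s := Finset.range r) (f := fun i => u (t / h) i)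
          rw [Finset.card_range] at h2
          refine h2.trans ?_
          rw [Finset.mul_sum (Finset.range r) _ δ]
          gcongr with i hi
          have a0 := hu0 (t / h) i (Finset.mem_range.1 hi)
          have a1 := hu1 (t / h) i (Finset.mem_range.1 hi)
          nlinarith
      _ = _ := by
          rw [sum_blocks (fun p => r * (δ * ∑ i ∈ Finset.range r, u p i)), Finset.sum_comm, ← Finset.mul_sum, ← Finset.mul_sum]
          ring
  have hub : ∀ T : ℝ, (∀ i < r, ∑ p ∈ Finset.range m, u p i ≤ T) →
      h * r * δ * ∑ i ∈ Finset.range r, ∑ p ∈ Finset.range m, u p i ≤ h * r ^ 2 * δ * T := by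
    intro T hT
    have : ∑ i ∈ Finset.range r, ∑ p ∈ Finset.range m, u p i ≤ r * T := by
      refine (Finset.sum_le_sum fun i hi => hT i (Finset.mem_range.1 hi)).trans ?_
      simp
    calc _ ≤ h * r * δ * (r * T) := by gcongr
      _ = _ := by ring
  refine ⟨main.trans (hub _ fun i hi => ?_), main.trans (hub _ fun i hi => ?_)⟩
  · refine (Finset.sum_le_sum fun p _ => hu1 p i hi).trans ?_
    simp
  · exact (Finset.sum_le_sum fun p _ => hu2 p i hi).trans (hy i hi)

lemma core (k : ℕ) : ∃ K : ℝ, 0 < K ∧ ∀ (L m : ℕ) (ε : ℝ), 0 < ε → ∀ a s : ℕ → ℝ,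
    (∀ i < k + 1, 0 ≤ s i) →
    Real.sqrt (2 ^ L) * (∑ j ∈ Finset.range (k + 1), ((2 : ℝ) ^ L) ^ j * s j) / ε ≤
      (2 ^ m) ^ (k + 1) →
    ∃ (M : ℕ) (A : Fin M → ℕ → ℝ), (M : ℝ) ≤ Real.exp (K * 2 ^ m) ∧
      ∀ f : ℕ → ℝ, Monotone (dseq^[k] f) → (∀ i < k + 1, a i ≤ dseq^[i] f 0) →
        (∀ i < k + 1, dseq^[i] f 0 ≤ a i + s i) →
        (∀ t, dseq^[k] f t - dseq^[k] f 0 ≤ s k) →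
        ∃ i, ∑ t ∈ Finset.range (2 ^ L), (f t - A i t) ^ 2 ≤ ε ^ 2 := by
  obtain ⟨K0, hK0, hpar⟩ := params k
  refine ⟨16 * (k + 1) * K0, by positivity, fun L m ε hε a s hs hX => ?_⟩
  choose d w hd hw herr hcost using fun l => hpar l m
  set W : ℝ := ∑ j ∈ Finset.range (k + 1), ((2 : ℝ) ^ L) ^ j * s j with hWdef
  set η : ℝ := ε / Real.sqrt (2 ^ L) with hη
  have hsq : 0 < Real.sqrt ((2 : ℝ) ^ L) := Real.sqrt_pos.2 (by positivity)
  have hη0 : 0 < η := div_pos hε hsq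
  have hηsq : (2 : ℝ) ^ L * (η * η) = ε ^ 2 := by
    rw [hη, div_mul_div_comm, Real.mul_self_sqrt (by positivity)]
    field_simp
  have hW : W ≤ η * (2 ^ m) ^ (k + 1) := by
    rw [div_le_iff₀ hε] at hX
    rw [hη, div_mul_eq_mul_div, le_div_iff₀ hsq]
    linarith
  have hx : ∀ l, 0 < 1 - Real.exp (-w l) := fun l => by
    have : Real.exp (-w l) < 1 := by rw [Real.exp_lt_one_iff]; linarith [hw l]
    linarith
  set Mb : ℕ → ℝ := fun l => (2 ^ m) ^ (k + 1) / 2 ^ (l * k) / d l with hMb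
  set B : ℝ := ∑ l ∈ Finset.range (L + 1), (k + 1) * (w l * Mb l) with hB
  have hB0 : 0 ≤ B := Finset.sum_nonneg fun l _ => by
    have h1 := hd l
    have h2 := hw l
    simp only [hMb]
    positivity
  obtain ⟨Q, hQ, hcard⟩ := gf_count
    (fun x : (Σ l : Fin (L + 1), Fin (2 ^ (l : ℕ)) × Fin (k + 1)) => w x.1) (fun x => hw _) B hB0
  let ex : ((Σ l : Fin (L + 1), Fin (2 ^ (l : ℕ)) × Fin (k + 1)) → ℕ) → ℕ → ℕ → ℕ → ℕ :=
    fun q l p i => if h : l < L + 1 then (if h2 : p < 2 ^ l then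
      (if h3 : i < k + 1 then q ⟨⟨l, h⟩, ⟨p, h2⟩, ⟨i, h3⟩⟩ else 0) else 0) else 0
  let Ap : ((Σ l : Fin (L + 1), Fin (2 ^ (l : ℕ)) × Fin (k + 1)) → ℕ) → ℕ → ℝ := fun q t =>
    ∑ i ∈ Finset.range (k + 1), (t.choose i : ℝ) * a i +
      ∑ l ∈ Finset.range (L + 1), ∑ i ∈ Finset.range (k + 1),
        ((t % 2 ^ (L - l)).choose i : ℝ) / ((2 : ℝ) ^ (L - l)) ^ i *
          (η * d l * (ex q l (t / 2 ^ (L - l)) i : ℝ))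
  refine ⟨Q.card, fun i => Ap (Q.equivFin.symm i), ?_, ?_⟩
  · refine hcard.trans (Real.exp_le_exp.2 ?_)
    rw [Fintype.sum_sigma]
    have h1 : ∑ l : Fin (L + 1), ∑ y : Fin (2 ^ (l : ℕ)) × Fin (k + 1),
        -Real.log (1 - Real.exp (-w l)) = ∑ l ∈ Finset.range (L + 1),
        (k + 1) * (2 ^ l * -Real.log (1 - Real.exp (-w l))) := by
      rw [Finset.sum_range]
      refine Finset.sum_congr rfl fun l _ => ?_
      simp
      ring
    rw [h1, hB, ← Finset.sum_add_distrib]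
    calc _ ≤ ∑ l ∈ Finset.range (L + 1), ((k : ℝ) + 1) * (K0 * 2 ^ m * rho l m) := by
          refine Finset.sum_le_sum fun l _ => ?_
          rw [← mul_add]
          have := hcost l
          gcongr
      _ = (k + 1) * K0 * 2 ^ m * ∑ l ∈ Finset.range (L + 1), rho l m := by
          rw [Finset.mul_sum]
          exact Finset.sum_congr rfl fun l _ => by ring
      _ ≤ (k + 1) * K0 * 2 ^ m * 16 := by
          have := rho_sum (L + 1) m
          gcongr
      _ = _ := by ring
  · intro f hf ha has hV
    have hδ : ∀ l, 0 < η * d l := fun l => mul_pos hη0 (hd l)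
    set y : ℕ → ℕ → ℕ → ℝ := fun l p i => ((2 : ℝ) ^ (L - l)) ^ i * cf k L f a l p i with hy
    have hy0 : ∀ l p, ∀ i < k + 1, 0 ≤ y l p i := fun l p i hi =>
      mul_nonneg (by positivity) (cf_nonneg k L f a hf ha l p i hi)
    have hyS : ∀ l ≤ L, ∀ i < k + 1, ∑ p ∈ Finset.range (2 ^ l), y l p i ≤ W / 2 ^ (l * k) :=
      fun l hl i hi => cf_sum k L f a s hf hs has hV l i hl hi
    let fl : ℕ → ℕ → ℕ → ℕ := fun l p i => ⌊y l p i / (η * d l)⌋₊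
    let q : (Σ l : Fin (L + 1), Fin (2 ^ (l : ℕ)) × Fin (k + 1)) → ℕ :=
      fun x => fl x.1 x.2.1 x.2.2
    have hq : q ∈ Q := by
      refine hQ q ?_
      rw [Fintype.sum_sigma, hB, Finset.sum_range]
      refine Finset.sum_le_sum fun l _ => ?_
      rw [Fintype.sum_prod_type_right]
      have h1 : ∀ i : Fin (k + 1), ∑ p : Fin (2 ^ (l : ℕ)), w l * (q ⟨l, p, i⟩ : ℝ) ≤ w l * Mb l := by
        intro i
        rw [← Finset.mul_sum]
        refine mul_le_mul_of_nonneg_left ?_ (hw l).le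
        calc ∑ p : Fin (2 ^ (l : ℕ)), (q ⟨l, p, i⟩ : ℝ)
            ≤ ∑ p : Fin (2 ^ (l : ℕ)), y l p i / (η * d l) := by
              refine Finset.sum_le_sum fun p _ => Nat.floor_le ?_
              exact div_nonneg (hy0 _ _ _ i.2) (hδ _).le
          _ = (∑ p ∈ Finset.range (2 ^ (l : ℕ)), y l p i) / (η * d l) := by
              rw [Finset.sum_range, Finset.sum_div]
          _ ≤ (W / 2 ^ ((l : ℕ) * k)) / (η * d l) := by
              refine div_le_div_of_nonneg_right (hyS l (by omega) i i.2) (hδ _).le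
          _ ≤ (η * (2 ^ m) ^ (k + 1) / 2 ^ ((l : ℕ) * k)) / (η * d l) := by
              refine div_le_div_of_nonneg_right ?_ (hδ _).le
              gcongr
          _ = Mb l := by
              simp only [hMb]
              have := hd l
              field_simp
      calc _ ≤ ∑ i : Fin (k + 1), w l * Mb l := Finset.sum_le_sum fun i _ => h1 i
        _ = _ := by simp
    refine ⟨Q.equivFin ⟨q, hq⟩, ?_⟩
    simp only [Equiv.symm_apply_apply]
    set u : ℕ → ℕ → ℕ → ℝ := fun l p i => y l p i - η * d l * (fl l p i : ℝ) with hu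
    set e : ℕ → ℕ → ℝ := fun l t => ∑ i ∈ Finset.range (k + 1),
      ((t % 2 ^ (L - l)).choose i : ℝ) / (((2 ^ (L - l) : ℕ)) : ℝ) ^ i * u l (t / 2 ^ (L - l)) i with he
    have hrep : ∀ t ∈ Finset.range (2 ^ L), f t - Ap q t = ∑ l ∈ Finset.range (L + 1), e l t := by
      intro t ht
      have ht := Finset.mem_range.1 ht
      have h1 := cf_repr k L f a t ht L le_rfl
      simp only [Nat.sub_self, pow_zero, Nat.div_one, Nat.mod_one, one_mul, tTay_zero] at h1
      rw [h1]
      simp only [Ap]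
      rw [add_sub_add_left_eq_sub, ← Finset.sum_sub_distrib]
      refine Finset.sum_congr rfl fun l hl => ?_
      have hl := Finset.mem_range.1 hl
      simp only [he]
      rw [← Finset.sum_sub_distrib]
      refine Finset.sum_congr rfl fun i hi => ?_
      have hi := Finset.mem_range.1 hi
      have hp : t / 2 ^ (L - l) < 2 ^ l := by
        rw [Nat.div_lt_iff_lt_mul (by positivity), ← pow_add, show l + (L - l) = L by omega]
        exact ht
      have hex : ex q l (t / 2 ^ (L - l)) i = fl l (t / 2 ^ (L - l)) i := by
        simp only [ex, hl, hp, hi, dif_pos, q]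
      rw [hex]
      simp only [hu, hy]
      push_cast
      field_simp
    have hlev : ∀ l ∈ Finset.range (L + 1),
        ∑ t ∈ Finset.range (2 ^ L), e l t ^ 2 ≤ ε ^ 2 * (rho l m ^ 2 / 256) := by
      intro l hl
      have hl : l ≤ L := by have := Finset.mem_range.1 hl; omega
      have h1 := level_err (k + 1) (2 ^ (L - l)) (2 ^ l) (by positivity) (u l) (y l) (η * d l)
        (W / 2 ^ (l * k)) (hδ l).le
        (fun p i hi => by
          have := Nat.floor_le (div_nonneg (hy0 l p i hi) (hδ l).le)
          rw [le_div_iff₀ (hδ l)] at this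
          simp only [hu, fl]
          linarith)
        (fun p i hi => by
          have := (Nat.lt_floor_add_one (y l p i / (η * d l))).le
          rw [div_le_iff₀ (hδ l)] at this
          simp only [hu, fl]
          linarith)
        (fun p i hi => by
          have : 0 ≤ η * d l * (fl l p i : ℝ) := mul_nonneg (hδ l).le (by positivity)
          simp only [hu]
          linarith)
        (fun i hi => hyS l hl i hi)
      rw [← pow_add, show l + (L - l) = L by omega] at h1
      have hNl : (2 : ℝ) ^ L = 2 ^ (L - l) * 2 ^ l := by rw [← pow_add, show L - l + l = L by omega]
      push_cast at h1
      have hd' := hd l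
      rcases herr l with h2 | h2
      · simp only [he]
        push_cast
        refine h1.1.trans ?_
        calc _ = (2 ^ L * (η * η)) * (256 * ((k : ℝ) + 1) ^ 2 * (d l * d l)) / 256 := by
              rw [hNl]; ring
          _ ≤ _ := by
              rw [hηsq, mul_div_assoc]
              gcongr
      · simp only [he]
        push_cast
        refine h1.2.trans ?_
        calc _ ≤ (2 : ℝ) ^ (L - l) * (k + 1) ^ 2 * (η * d l) *
                (η * (2 ^ m) ^ (k + 1) / 2 ^ (l * k)) := by gcongr
          _ = (2 ^ L * (η * η)) * (256 * ((k : ℝ) + 1) ^ 2 *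
                (d l * ((2 ^ m) ^ (k + 1) / 2 ^ (l * (k + 1))))) / 256 := by
              rw [hNl, show l * (k + 1) = l * k + l by ring, pow_add _ (l * k)]
              field_simp
          _ ≤ _ := by
              rw [hηsq, mul_div_assoc]
              gcongr
    calc ∑ t ∈ Finset.range (2 ^ L), (f t - Ap q t) ^ 2
        ≤ ∑ t ∈ Finset.range (2 ^ L), 16 * ∑ l ∈ Finset.range (L + 1), e l t ^ 2 / rho l m := by
          refine Finset.sum_le_sum fun t ht => ?_
          rw [hrep t ht]
          refine (Finset.sum_sq_le_sum_mul_sum_of_sq_le_mul (Finset.range (L + 1))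
            (f := fun l => rho l m) (g := fun l => e l t ^ 2 / rho l m)
            (fun l _ => (rho_pos l m).le)
            (fun l _ => div_nonneg (sq_nonneg _) (rho_pos l m).le) (fun l _ => ?_)).trans ?_
          · have := rho_pos l m
            refine le_of_eq ?_
            field_simp
          · refine mul_le_mul_of_nonneg_right (rho_sum _ _) (Finset.sum_nonneg fun l _ => ?_)
            exact div_nonneg (sq_nonneg _) (rho_pos l m).le
      _ = 16 * ∑ l ∈ Finset.range (L + 1), (∑ t ∈ Finset.range (2 ^ L), e l t ^ 2) / rho l m := by
          rw [← Finset.mul_sum, Finset.sum_comm]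
          simp only [Finset.sum_div]
      _ ≤ 16 * ∑ l ∈ Finset.range (L + 1), ε ^ 2 / 256 * rho l m := by
          gcongr with l hl
          have h0 := rho_pos l m
          rw [div_le_iff₀ h0]
          refine (hlev l hl).trans (le_of_eq (by ring))
      _ = ε ^ 2 / 16 * ∑ l ∈ Finset.range (L + 1), rho l m := by
          rw [← Finset.mul_sum]; ring
      _ ≤ ε ^ 2 / 16 * 16 := by
          have := rho_sum (L + 1) m
          gcongr
      _ = ε ^ 2 := by ring

lemma cras_extend (k n : ℕ) (hn : k + 1 ≤ n) (a s : ℕ → ℝ) (θ : Fin n → ℝ)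
    (hθ : θ ∈ Cras (k + 1) n a s) : ∃ f : ℕ → ℝ, (∀ t : Fin n, f t = θ t) ∧
      Monotone (dseq^[k] f) ∧ (∀ i < k + 1, a i ≤ dseq^[i] f 0) ∧
        (∀ i < k + 1, dseq^[i] f 0 ≤ a i + s i) ∧
        (∀ t, dseq^[k] f t ≤ a k + s k) := by
  obtain ⟨h1, h2, h3, h4⟩ := hθ
  simp only [Nat.add_sub_cancel, DD] at h1 h2 h3 h4
  obtain ⟨f, hf1, hf2⟩ := ext_exists k (pad θ) (n - k) (by omega)
  have hmono : Monotone (dseq^[k] f) := by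
    refine monotone_nat_of_le_succ fun t => ?_
    rw [hf2, hf2]
    by_cases ht : t + 1 ≤ n - (k + 1)
    · rw [min_eq_left (by omega), min_eq_left (by omega)]
      exact h3 t ht
    · rw [min_eq_right (by omega), min_eq_right (by omega)]
  have hub : ∀ t, dseq^[k] f t ≤ a k + s k := fun t => by
    refine (hmono (show t ≤ t + (n - (k + 1)) by omega)).trans ?_
    rw [hf2, min_eq_right (by omega), show n - k - 1 = n - (k + 1) by omega]
    exact h4
  have h0 : ∀ i < k + 1, dseq^[i] f 0 = dseq^[i] (pad θ) 0 := fun i hi =>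
    dseq_congr i f (pad θ) 1 (fun t ht => hf1 t (by omega)) 0 (by omega)
  refine ⟨f, fun t => ?_, hmono, fun i hi => ?_, fun i hi => ?_, hub⟩
  · rw [hf1 t (by omega)]
    simp [pad]
  · rw [h0 i hi]
    rcases Nat.lt_succ_iff_lt_or_eq.1 hi with h | rfl
    · exact (h1 i h).1
    · exact h2
  · rcases Nat.lt_succ_iff_lt_or_eq.1 hi with h | rfl
    · rw [h0 i hi]
      exact (h1 i h).2
    · exact hub 0

lemma covN_le {n : ℕ} (ε : ℝ) (K : Set (Fin n → ℝ)) (M : ℕ) (A : Fin M → Fin n → ℝ)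
    (h : ∀ x ∈ K, ∃ i, eunorm (x - A i) ≤ ε) : covN ε K ≤ M :=
  Nat.sInf_le ⟨A, h⟩

lemma log_covN_le {n : ℕ} (ε : ℝ) (K : Set (Fin n → ℝ)) (M : ℕ) (E : ℝ) (hE : 0 ≤ E)
    (hM : (M : ℝ) ≤ Real.exp E) (h : covN ε K ≤ M) : Real.log (covN ε K) ≤ E := by
  rcases Nat.eq_zero_or_pos (covN ε K) with h0 | h0
  · rw [h0]; simpa using hE
  · rw [Real.log_le_iff_le_exp (by exact_mod_cast h0)]
    exact le_trans (by exact_mod_cast h) hM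

/-- Lemma: metric entropy bound for the class `C_r({a_i}, {s_i})`.
The data `a, s : ℕ → ℝ` carry the values `a_0, …, a_{r-1}` and `s_0, …, s_{r-1}`. -/
theorem stmt15 (r : ℕ) (hr : 1 ≤ r) :
    ∃ C : ℝ, 0 < C ∧
      ∀ (n : ℕ), r ≤ n → ∀ ε : ℝ, 0 < ε → ∀ a s : ℕ → ℝ, (∀ i < r, 0 ≤ s i) →
        Real.log (covN ε (Cras r n a s)) ≤
          C * (Real.sqrt (n : ℝ) *
              (∑ jj ∈ Finset.range r, (n : ℝ) ^ jj * s jj) / ε) ^ ((1 : ℝ) / (r : ℝ)) := by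
  obtain ⟨k, rfl⟩ : ∃ k, r = k + 1 := ⟨r - 1, by omega⟩
  obtain ⟨K, hK, hcore⟩ := core k
  refine ⟨K * 4, by positivity, fun n hn ε hε a s hs => ?_⟩
  set W : ℝ := ∑ jj ∈ Finset.range (k + 1), (n : ℝ) ^ jj * s jj with hW
  have hW0 : 0 ≤ W := Finset.sum_nonneg fun i hi => by
    have := hs i (Finset.mem_range.1 hi)
    positivity
  set X : ℝ := Real.sqrt n * W / ε with hX
  have hX0 : 0 ≤ X := by positivity
  rcases le_or_gt X 1 with hX1 | hX1
  · refine log_covN_le ε _ 1 _ (by positivity)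
      (by simpa using Real.one_le_exp (by positivity)) ?_
    refine covN_le ε _ 1
      (fun _ t => ∑ i ∈ Finset.range (k + 1), ((t : ℕ).choose i : ℝ) * a i) fun θ hθ => ⟨0, ?_⟩
    obtain ⟨f, hf, hmono, h1, h2, h3⟩ := cras_extend k n hn a s θ hθ
    have hb : ∀ t : Fin n, (θ t - ∑ i ∈ Finset.range (k + 1), ((t : ℕ).choose i : ℝ) * a i) ^ 2 ≤
        W ^ 2 := by
      intro t
      obtain ⟨b1, b2⟩ := tRem_bounds k f hmono 0 t
      rw [zero_add] at b2
      unfold tRem at b1 b2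
      rw [zero_add, hf t] at b1 b2
      have e1 : ∑ i ∈ Finset.range (k + 1), ((t : ℕ).choose i : ℝ) * a i ≤
          ∑ i ∈ Finset.range (k + 1), ((t : ℕ).choose i : ℝ) * dseq^[i] f 0 := by
        refine Finset.sum_le_sum fun i hi => ?_
        have := h1 i (Finset.mem_range.1 hi)
        gcongr
      have hch : ∀ i, ((t : ℕ).choose i : ℝ) ≤ (n : ℝ) ^ i := fun i => by
        have : (t : ℕ).choose i ≤ n ^ i :=
          (Nat.choose_le_pow _ _).trans (Nat.pow_le_pow_left t.2.le _)
        exact_mod_cast this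
      have htn : ((t : ℕ) : ℝ) ≤ n := by exact_mod_cast t.2.le
      have hm0 : dseq^[k] f 0 ≤ dseq^[k] f t := hmono (Nat.zero_le _)
      have e2 : ∑ i ∈ Finset.range (k + 1), ((t : ℕ).choose i : ℝ) * dseq^[i] f 0 +
          ((t : ℕ) : ℝ) ^ k * (dseq^[k] f t - dseq^[k] f 0) ≤
          ∑ i ∈ Finset.range (k + 1), ((t : ℕ).choose i : ℝ) * a i + W := by
        rw [hW, ← Finset.sum_add_distrib, Finset.sum_range_succ, Finset.sum_range_succ _ k, add_assoc]
        refine add_le_add (Finset.sum_le_sum fun i hi => ?_) ?_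
        · have hi := Finset.mem_range.1 hi
          have g1 := h2 i (by omega)
          have g2 := hs i (by omega)
          calc ((t : ℕ).choose i : ℝ) * dseq^[i] f 0 ≤ ((t : ℕ).choose i : ℝ) * (a i + s i) := by gcongr
            _ = ((t : ℕ).choose i : ℝ) * a i + ((t : ℕ).choose i : ℝ) * s i := by ring
            _ ≤ _ := by
              have := mul_le_mul_of_nonneg_right (hch i) g2
              linarith
        · have g1 := h1 k (by omega)
          have g3 := h3 t
          calc ((t : ℕ).choose k : ℝ) * dseq^[k] f 0 + ((t : ℕ) : ℝ) ^ k * (dseq^[k] f t - dseq^[k] f 0)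
              = ((t : ℕ).choose k : ℝ) * a k + (((t : ℕ).choose k : ℝ) * (dseq^[k] f 0 - a k) +
                ((t : ℕ) : ℝ) ^ k * (dseq^[k] f t - dseq^[k] f 0)) := by ring
            _ ≤ ((t : ℕ).choose k : ℝ) * a k + ((n : ℝ) ^ k * (dseq^[k] f 0 - a k) +
                (n : ℝ) ^ k * (dseq^[k] f t - dseq^[k] f 0)) := by
                have i1 := mul_le_mul_of_nonneg_right (hch k) (sub_nonneg.2 g1)
                have i2 := mul_le_mul_of_nonneg_right
                  (pow_le_pow_left₀ (by positivity) htn k) (sub_nonneg.2 hm0)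
                linarith
            _ = ((t : ℕ).choose k : ℝ) * a k + (n : ℝ) ^ k * (dseq^[k] f t - a k) := by ring
            _ ≤ _ := by
                gcongr
                linarith
      refine pow_le_pow_left₀ (by linarith) (by linarith) 2
    have hXε : Real.sqrt n * W ≤ ε := by
      rw [hX, div_le_one hε] at hX1
      exact hX1
    refine le_trans ?_ hXε
    unfold eunorm sqnorm
    refine Real.sqrt_le_iff.2 ⟨by positivity, ?_⟩
    rw [mul_pow, Real.sq_sqrt (by positivity)]
    refine (Finset.sum_le_sum fun t _ => hb t).trans ?_
    simp
  · set Y : ℝ := X ^ ((1 : ℝ) / ((k + 1 : ℕ) : ℝ)) with hY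
    have hY1 : 1 ≤ Y := Real.one_le_rpow hX1.le (by positivity)
    have hYX : Y ^ (k + 1) = X := by
      rw [hY, one_div]
      exact Real.rpow_inv_natCast_pow hX0 (by omega)
    obtain ⟨m, hm1, hm2⟩ := exists_nat_pow_near hY1 (one_lt_two : (1 : ℝ) < 2)
    obtain ⟨L, hL1, hL2⟩ : ∃ L : ℕ, n ≤ 2 ^ L ∧ 2 ^ L ≤ 2 * n := by
      obtain ⟨j, hj1, hj2⟩ := exists_nat_pow_near (show 1 ≤ n by omega) (one_lt_two : 1 < 2)
      exact ⟨j + 1, hj2.le, by rw [pow_succ]; omega⟩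
    have hL2' : (2 : ℝ) ^ L ≤ 2 * n := by exact_mod_cast hL2
    have hbig : Real.sqrt (2 ^ L) * (∑ j ∈ Finset.range (k + 1), ((2 : ℝ) ^ L) ^ j * s j) / ε ≤
        (2 ^ (m + 2)) ^ (k + 1) := by
      have i1 : Real.sqrt (2 ^ L) ≤ 2 * Real.sqrt n := by
        refine Real.sqrt_le_iff.2 ⟨by positivity, ?_⟩
        rw [mul_pow, Real.sq_sqrt (by positivity)]
        have : (0 : ℝ) ≤ n := by positivity
        linarith
      have i2 : ∑ j ∈ Finset.range (k + 1), ((2 : ℝ) ^ L) ^ j * s j ≤ 2 ^ k * W := by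
        rw [hW, Finset.mul_sum]
        refine Finset.sum_le_sum fun j hj => ?_
        have hj := Finset.mem_range.1 hj
        have hsj := hs j hj
        rw [← mul_assoc]
        refine mul_le_mul_of_nonneg_right ?_ hsj
        calc ((2 : ℝ) ^ L) ^ j ≤ (2 * n) ^ j := by gcongr
          _ = 2 ^ j * (n : ℝ) ^ j := mul_pow _ _ _
          _ ≤ _ := by
            have : (2 : ℝ) ^ j ≤ 2 ^ k := pow_le_pow_right₀ (by norm_num) (by omega)
            gcongr
      have i3 : 0 ≤ ∑ j ∈ Finset.range (k + 1), ((2 : ℝ) ^ L) ^ j * s j :=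
        Finset.sum_nonneg fun i hi => by
          have := hs i (Finset.mem_range.1 hi)
          positivity
      calc _ ≤ (2 * Real.sqrt n) * (2 ^ k * W) / ε := by gcongr
        _ = 2 ^ (k + 1) * X := by rw [hX]; ring
        _ = (2 * Y) ^ (k + 1) := by rw [mul_pow, hYX]
        _ ≤ _ := by
          refine pow_le_pow_left₀ (by positivity) ?_ _
          rw [show m + 2 = (m + 1) + 1 by ring, pow_succ 2 (m + 1)]
          linarith
    obtain ⟨M, A, hM, hA⟩ := hcore L (m + 2) ε hε a s hs hbig
    refine le_trans (log_covN_le ε _ M (K * 2 ^ (m + 2)) (by positivity) hM ?_) ?_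
    · refine covN_le ε _ M (fun i t => A i t) fun θ hθ => ?_
      obtain ⟨f, hf, hmono, h1, h2, h3⟩ := cras_extend k n hn a s θ hθ
      obtain ⟨i, hi⟩ := hA f hmono h1 h2 (fun t => by
        have := h3 t
        have := h1 k (by omega)
        linarith)
      refine ⟨i, ?_⟩
      unfold eunorm sqnorm
      refine Real.sqrt_le_iff.2 ⟨hε.le, le_trans ?_ hi⟩
      calc ∑ t : Fin n, (θ - fun t : Fin n => A i t) t ^ 2
          = ∑ t ∈ Finset.range n, (f t - A i t) ^ 2 := by
            rw [Finset.sum_range]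
            refine Finset.sum_congr rfl fun t _ => ?_
            rw [Pi.sub_apply, hf t]
        _ ≤ _ := Finset.sum_le_sum_of_subset_of_nonneg (Finset.range_mono hL1)
            fun t _ _ => sq_nonneg _
    · rw [pow_add, mul_assoc]
      refine mul_le_mul_of_nonneg_left ?_ hK.le
      linarith
end
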